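/- Let k be a field of characteristic p > 0 and let G be a finite subgroup of PGL_2(k). Then G contains a characteristic cyclic subgroup of order coprime to p and index at most J_p·|G_(p)|^3, where J_p = 60 if p ≥ 7, J_p = 24 if p = 5, J_p = 4 if p = 3, and J_p = 1 if p = 2. -/

import Mathlib

/-- `sylowCard p G` is the order of a `p`-Sylow subgroup of the finite group `G`,
i.e. the largest power of `p` dividing `|G|`. -/
noncomputable def sylowCard (p : ℕ) (G : Type*) [Group G] : ℕ := p ^ (Nat.card G).factorization p

/-- `PGL₂(K)`: the quotient of `GL₂(K)` by its center. -/
abbrev PGL2 (K : Type*) [Field K] : Type _ :=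
  GL (Fin 2) K ⧸ Subgroup.center (GL (Fin 2) K)

section MoebiusAction

open MulAction

/-- The properties of the action of a finite group of fractional linear transformations on
points of the projective line in characteristic `p`: `χ x g` is the multiplier at the point `x`
of a transformation `g` fixing `x`. -/
structure IsMoebiusAction (p : ℕ) {G X K : Type*} [Group G] [MulAction G X] [Field K]
    (χ : X → G → K) : Prop where
  map_one : ∀ x, χ x 1 = 1
  map_mul : ∀ x g h, g • x = x → h • x = x → χ x (g * h) = χ x g * χ x h
  exists_fixed : ∀ g : G, g ≠ 1 → ∃ x : X, g • x = x
  fixed_unique : ∀ g : G, g ≠ 1 → ∀ x y : X, g • x = x → χ x g = 1 → g • y = y → y = x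
  fixed_pair : ∀ (g : G) (x : X), g • x = x → χ x g ≠ 1 →
    ∃ y, y ≠ x ∧ g • y = y ∧ ∀ z, g • z = z → z = x ∨ z = y
  pow_eq_one : ∀ (g : G) (x : X), g • x = x → χ x g = 1 → g ^ p = 1

namespace IsMoebiusAction

variable {p : ℕ} {G X K : Type*} [Group G] [MulAction G X] [Field K] {χ : X → G → K}

/-- The multiplier at `x` as a homomorphism on the stabilizer of `x`. -/
def multiplier (h : IsMoebiusAction p χ) (x : X) : stabilizer G x →* K where
  toFun g := χ x g
  map_one' := h.map_one x
  map_mul' a b := h.map_mul x a b a.2 b.2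

/-- The subgroup of transformations which fix `x` with multiplier one. -/
def unipotent (h : IsMoebiusAction p χ) (x : X) : Subgroup G :=
  (h.multiplier x).ker.map (stabilizer G x).subtype

theorem mem_unipotent (h : IsMoebiusAction p χ) {x : X} {g : G} :
    g ∈ h.unipotent x ↔ g • x = x ∧ χ x g = 1 := by
  simp [unipotent, multiplier, MonoidHom.mem_ker, and_comm]

theorem unipotent_le (h : IsMoebiusAction p χ) (x : X) : h.unipotent x ≤ stabilizer G x :=
  fun _ hg ↦ (h.mem_unipotent.1 hg).1

theorem isPGroup_unipotent (h : IsMoebiusAction p χ) (x : X) : IsPGroup p (h.unipotent x) := by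
  rintro ⟨g, hg⟩
  rw [h.mem_unipotent] at hg
  exact ⟨1, Subtype.ext (by simpa using h.pow_eq_one g x hg.1 hg.2)⟩

theorem multiplier_eq_one_of_pow [CharP K p] [Fact p.Prime] (h : IsMoebiusAction p χ) {x : X}
    {g : G} (hg : g • x = x) {n : ℕ} (hn : g ^ p ^ n = 1) : χ x g = 1 := by
  have h1 : (h.multiplier x ⟨g, hg⟩) ^ p ^ n = 1 := by
    rw [← _root_.map_pow, ← _root_.map_one (h.multiplier x)]
    exact congrArg _ (Subtype.ext hn)
  have h2 : (χ x g - 1) ^ p ^ n = 0 := by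
    rw [sub_pow_char_pow, one_pow, sub_eq_zero]
    exact h1
  exact sub_eq_zero.1 (pow_eq_zero_iff (pow_ne_zero _ (Fact.out : p.Prime).ne_zero) |>.1 h2)

theorem isCyclic_stabilizer [Finite G] (h : IsMoebiusAction p χ) {x : X}
    (hx : h.unipotent x = ⊥) : IsCyclic (stabilizer G x) := by
  refine isCyclic_of_injective_ringHom (h.multiplier x) ((injective_iff_map_eq_one _).2 ?_)
  rintro ⟨g, hg⟩ hg1
  have : g ∈ h.unipotent x := h.mem_unipotent.2 ⟨hg, hg1⟩
  rw [hx, Subgroup.mem_bot] at this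
  exact Subtype.ext this

theorem coprime_card_stabilizer [Finite G] [CharP K p] [hp : Fact p.Prime]
    (h : IsMoebiusAction p χ) {x : X} (hx : h.unipotent x = ⊥) :
    (Nat.card (stabilizer G x)).Coprime p := by
  refine ((Nat.Prime.coprime_iff_not_dvd hp.out).2 fun hdvd ↦ ?_).symm
  obtain ⟨g, hg⟩ := exists_prime_orderOf_dvd_card' p hdvd
  have hgp : (g : G) ^ p ^ 1 = 1 := by
    rw [pow_one, ← hg, ← Subgroup.orderOf_coe, pow_orderOf_eq_one]
  have h1 : (g : G) ∈ h.unipotent x :=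
    h.mem_unipotent.2 ⟨g.2, h.multiplier_eq_one_of_pow g.2 hgp⟩
  rw [hx, Subgroup.mem_bot, OneMemClass.coe_eq_one] at h1
  rw [h1, orderOf_one] at hg
  exact hp.out.one_lt.ne hg

/-- A nontrivial unipotent subgroup is a Sylow subgroup. -/
theorem eq_unipotent_of_le [Finite G] [CharP K p] [hp : Fact p.Prime]
    (h : IsMoebiusAction p χ) {x : X} (hx : h.unipotent x ≠ ⊥) {Q : Subgroup G}
    (hQ : IsPGroup p Q) (hle : h.unipotent x ≤ Q) : Q = h.unipotent x := by
  refine le_antisymm ?_ hle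
  obtain ⟨u, hu, hu1⟩ := (Subgroup.bot_or_exists_ne_one _).resolve_left hx
  have hu' := h.mem_unipotent.1 hu
  have : Nontrivial Q := ⟨⟨⟨u, hle hu⟩, 1, fun h0 ↦ hu1 (congrArg Subtype.val h0)⟩⟩
  have := hQ.center_nontrivial
  obtain ⟨z, hz⟩ := exists_ne (1 : Subgroup.center Q)
  have hzG : ((z : Q) : G) ≠ 1 := fun h0 ↦ hz (Subtype.ext (Subtype.ext h0))
  have hcomm : ∀ g ∈ Q, g * ((z : Q) : G) = ((z : Q) : G) * g := fun g hg ↦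
    congrArg Subtype.val (Subgroup.mem_center_iff.1 z.2 ⟨g, hg⟩)
  have hzx : ((z : Q) : G) • x = x := by
    refine h.fixed_unique u hu1 x _ hu'.1 hu'.2 ?_
    rw [smul_smul, hcomm u (hle hu), mul_smul, hu'.1]
  have hχ : ∀ g ∈ Q, g • x = x → χ x g = 1 := fun g hg hgx ↦ by
    obtain ⟨n, hn⟩ := hQ ⟨g, hg⟩
    exact h.multiplier_eq_one_of_pow hgx (congrArg Subtype.val hn)
  intro g hg
  have hgx : g • x = x := by
    refine h.fixed_unique _ hzG x _ hzx (hχ _ (z : Q).2 hzx) ?_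
    rw [smul_smul, ← hcomm g hg, mul_smul, hzx]
  exact h.mem_unipotent.2 ⟨hgx, hχ g hg hgx⟩

theorem exists_sylow_eq [Finite G] [CharP K p] [Fact p.Prime]
    (h : IsMoebiusAction p χ) {x : X} (hx : h.unipotent x ≠ ⊥) :
    ∃ P : Sylow p G, (P : Subgroup G) = h.unipotent x :=
  ⟨⟨h.unipotent x, h.isPGroup_unipotent x, fun hQ hle ↦ h.eq_unipotent_of_le hx hQ hle⟩, rfl⟩

theorem card_unipotent [Finite G] [CharP K p] [Fact p.Prime]
    (h : IsMoebiusAction p χ) {x : X} (hx : h.unipotent x ≠ ⊥) :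
    Nat.card (h.unipotent x) = sylowCard p G := by
  obtain ⟨P, hP⟩ := h.exists_sylow_eq hx
  rw [← hP, sylowCard]
  exact P.card_eq_multiplicity

theorem unipotent_smul (h : IsMoebiusAction p χ) {x : X} {g u : G} (hu : u ∈ h.unipotent x) :
    g * u * g⁻¹ ∈ h.unipotent (g • x) := by
  by_cases hu1 : u = 1
  · simp [hu1, one_mem]
  have hu' := h.mem_unipotent.1 hu
  have hfix : (g * u * g⁻¹) • g • x = g • x := by simp [mul_smul, hu'.1]
  refine h.mem_unipotent.2 ⟨hfix, by_contra fun hne ↦ ?_⟩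
  obtain ⟨y, hy, hgy, -⟩ := h.fixed_pair _ _ hfix hne
  refine hy ?_
  rw [← inv_smul_eq_iff]
  refine h.fixed_unique u hu1 x _ hu'.1 hu'.2 ?_
  rw [eq_inv_smul_iff, smul_smul, smul_smul, hgy]

theorem unipotent_smul_ne_bot (h : IsMoebiusAction p χ) {x : X} (g : G)
    (hx : h.unipotent x ≠ ⊥) : h.unipotent (g • x) ≠ ⊥ := by
  rw [Subgroup.ne_bot_iff_exists_ne_one] at hx ⊢
  obtain ⟨u, hu⟩ := hx
  refine ⟨⟨_, h.unipotent_smul (g := g) u.2⟩, fun h0 ↦ hu (Subtype.ext ?_)⟩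
  simpa using congrArg Subtype.val h0

/-- The points with nontrivial unipotent stabilizer form a single orbit. -/
theorem unipotent_ne_bot_iff [Finite G] [CharP K p] [Fact p.Prime]
    (h : IsMoebiusAction p χ) {x y : X} (hx : h.unipotent x ≠ ⊥) :
    h.unipotent y ≠ ⊥ ↔ y ∈ orbit G x := by
  constructor
  · intro hy
    obtain ⟨P, hP⟩ := h.exists_sylow_eq hx
    obtain ⟨Q, hQ⟩ := h.exists_sylow_eq hy
    obtain ⟨g, rfl⟩ := exists_smul_eq G P Q
    refine ⟨g, ?_⟩
    obtain ⟨u, hu, hu1⟩ := (Subgroup.bot_or_exists_ne_one _).resolve_left hx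
    have h1 : g * u * g⁻¹ ∈ h.unipotent y := by
      rw [← hQ, Sylow.coe_subgroup_smul, hP]
      exact ⟨u, hu, rfl⟩
    have h1' := h.mem_unipotent.1 h1
    exact h.fixed_unique (g * u * g⁻¹) (by simpa using hu1) y _ h1'.1 h1'.2
      (h.mem_unipotent.1 (h.unipotent_smul hu)).1
  · rintro ⟨g, rfl⟩
    exact h.unipotent_smul_ne_bot g hx

/-- The order of the stabilizer is bounded via the conjugation action on unipotents. -/
theorem exists_card_stabilizer_eq [Finite G] (h : IsMoebiusAction p χ) {x : X}
    (hx : h.unipotent x ≠ ⊥) : ∃ m, Nat.card (stabilizer G x) = Nat.card (h.unipotent x) * m ∧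
      m < Nat.card (h.unipotent x) := by
  obtain ⟨m, hm⟩ := Subgroup.card_dvd_of_le (h.unipotent_le x)
  refine ⟨m, hm, ?_⟩
  obtain ⟨u, hu, hu1⟩ := (Subgroup.bot_or_exists_ne_one _).resolve_left hx
  have hu' := h.mem_unipotent.1 hu
  have hconj : ∀ g ∈ stabilizer G x, g * u * g⁻¹ ∈ h.unipotent x := fun g hg ↦ by
    have := h.unipotent_smul (g := g) hu
    rwa [hg] at this
  have hker : ∀ g, g • x = x → g * u = u * g → g ∈ h.unipotent x := by
    intro g hg hgu
    refine h.mem_unipotent.2 ⟨hg, by_contra fun hne ↦ ?_⟩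
    obtain ⟨y, hy, hgy, hz⟩ := h.fixed_pair g x hg hne
    rcases hz (u • y) (by rw [smul_smul, hgu, mul_smul, hgy]) with h1 | h1
    · exact hy (smul_left_cancel u (h1.trans hu'.1.symm))
    · exact hy (h.fixed_unique u hu1 x y hu'.1 hu'.2 h1)
  let U := (h.unipotent x).subgroupOf (stabilizer G x)
  have hidx : Nat.card (stabilizer G x ⧸ U) = m := by
    have h1 := Subgroup.card_eq_card_quotient_mul_card_subgroup U
    have h2 : Nat.card U = Nat.card (h.unipotent x) :=
      Nat.card_congr (Subgroup.subgroupOfEquivOfLe (h.unipotent_le x)).toEquiv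
    rw [hm, h2, mul_comm] at h1
    exact (Nat.eq_of_mul_eq_mul_right Nat.card_pos h1).symm
  let f : stabilizer G x ⧸ U → {v : h.unipotent x // v ≠ 1} := fun c ↦
    ⟨⟨(c.out : G) * u * (c.out : G)⁻¹, hconj _ c.out.2⟩, fun h0 ↦ hu1 (by
      simpa using congrArg Subtype.val h0)⟩
  have hf : Function.Injective f := by
    intro c d hcd
    have h1 : (c.out : G) * u * (c.out : G)⁻¹ = (d.out : G) * u * (d.out : G)⁻¹ :=
      congrArg Subtype.val (congrArg Subtype.val hcd)
    rw [← c.out_eq', ← d.out_eq', QuotientGroup.eq, Subgroup.mem_subgroupOf]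
    refine hker _ (c.out⁻¹ * d.out).2 ?_
    have h2 : (c.out : G)⁻¹ * ((c.out : G) * u * (c.out : G)⁻¹) * d.out =
      (c.out : G)⁻¹ * ((d.out : G) * u * (d.out : G)⁻¹) * d.out := by rw [h1]
    simpa [mul_assoc] using h2.symm
  have h1 := Nat.card_le_card_of_injective f hf
  rw [hidx] at h1
  refine h1.trans_lt ?_
  have := Fintype.ofFinite G
  classical
  rw [Nat.card_eq_fintype_card, Nat.card_eq_fintype_card]
  exact Fintype.card_subtype_lt (x := 1) (by simp)

theorem sum_card_add_two [Fintype G] [Fintype X] (h : IsMoebiusAction p χ) :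
    ∑ x, (Nat.card (stabilizer G x) + Nat.card (h.unipotent x)) + 2 =
      2 * Fintype.card X + 2 * Fintype.card G := by
  classical
  have h1 : ∀ x, Nat.card (stabilizer G x) + Nat.card (h.unipotent x) =
      ∑ g : G, ((if g • x = x then 1 else 0) + if g • x = x ∧ χ x g = 1 then 1 else 0) := by
    intro x
    rw [Finset.sum_add_distrib, ← Finset.card_filter, ← Finset.card_filter,
      ← Fintype.card_subtype, ← Fintype.card_subtype, ← Nat.card_eq_fintype_card,
      ← Nat.card_eq_fintype_card]
    congr 1
    exact Nat.card_congr (Equiv.subtypeEquivRight fun g ↦ h.mem_unipotent)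
  have h2 : ∀ g ∈ Finset.univ.erase (1 : G),
      ∑ x, ((if g • x = x then 1 else 0) + if g • x = x ∧ χ x g = 1 then 1 else 0) = 2 := by
    intro g hg
    have hg1 := Finset.ne_of_mem_erase hg
    obtain ⟨x, hx⟩ := h.exists_fixed g hg1
    by_cases hχ : χ x g = 1
    · have : ∀ y, g • y = y ↔ y = x := fun y ↦
        ⟨h.fixed_unique g hg1 x y hx hχ, fun hy ↦ hy ▸ hx⟩
      rw [Finset.sum_eq_single x (fun y _ hy ↦ by simp [this, hy]) (by simp)]
      simp [hx, hχ]
    · obtain ⟨y, hyx, hy, hz⟩ := h.fixed_pair g x hx hχ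
      have hχy : χ y g ≠ 1 := fun h0 ↦ hyx (h.fixed_unique g hg1 y x hy h0 hx).symm
      rw [Finset.sum_eq_add x y hyx.symm (fun z _ hzne ↦ ?_) (by simp) (by simp)]
      · simp [hx, hχ, hy, hχy]
      · have : ¬ g • z = z := fun h0 ↦ by rcases hz z h0 with h0 | h0 <;> simp_all
        simp [this]
  simp_rw [h1]
  rw [Finset.sum_comm, ← Finset.add_sum_erase _ _ (Finset.mem_univ (1 : G)),
    Finset.sum_congr rfl h2]
  have := Fintype.card_pos (α := G)
  simp [h.map_one, Finset.card_erase_of_mem]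
  lia

theorem sum_card_stabilizer [Fintype G] [Fintype X] [Fintype (orbitRel.Quotient G X)] :
    ∑ x : X, Nat.card (stabilizer G x) =
      Fintype.card (orbitRel.Quotient G X) * Fintype.card G := by
  classical
  rw [← sum_card_fixedBy_eq_card_orbits_mul_card_group]
  have h1 : ∀ x : X, Nat.card (stabilizer G x) = ∑ g : G, if g • x = x then 1 else 0 := by
    intro x
    rw [← Finset.card_filter, ← Fintype.card_subtype, ← Nat.card_eq_fintype_card]
    rfl
  have h2 : ∀ g : G, Fintype.card (fixedBy X g) = ∑ x : X, if g • x = x then 1 else 0 := by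
    intro g
    rw [← Finset.card_filter, ← Fintype.card_subtype]
    rfl
  simp_rw [h1, h2]
  exact Finset.sum_comm

theorem card_eq_sum_card_orbit [Fintype X] [Fintype (orbitRel.Quotient G X)] :
    Fintype.card X = ∑ ω : orbitRel.Quotient G X, Nat.card (orbit G ω.out) := by
  classical
  rw [Fintype.card_congr (selfEquivSigmaOrbits G X), Fintype.card_sigma]
  simp_rw [Nat.card_eq_fintype_card]

theorem card_orbit_mul_card_stabilizer [Fintype G] (x : X) :
    Nat.card (orbit G x) * Nat.card (stabilizer G x) = Fintype.card G := by
  rw [← Nat.card_prod, Nat.card_congr (orbitProdStabilizerEquivGroup G x),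
    Nat.card_eq_fintype_card]

theorem card_stabilizer_eq_of_mem_orbit [Finite G] {x y : X} (hy : y ∈ orbit G x) :
    Nat.card (stabilizer G y) = Nat.card (stabilizer G x) := by
  have := Fintype.ofFinite G
  have h1 := card_orbit_mul_card_stabilizer (G := G) x
  have h2 := card_orbit_mul_card_stabilizer (G := G) y
  rw [orbit_eq_iff.2 hy, ← h1] at h2
  have : Finite (orbit G x) := Set.finite_range _
  have : Nonempty (orbit G x) := ⟨⟨x, mem_orbit_self x⟩⟩
  exact Nat.eq_of_mul_eq_mul_left Nat.card_pos h2

/-- There is a characteristic cyclic subgroup of order prime to `p` and index at most `B`. -/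
def _root_.HasCyclicCharacteristic (p : ℕ) (G : Type*) [Group G] (B : ℕ) : Prop :=
  ∃ A : Subgroup G, A.Characteristic ∧ IsCyclic A ∧ (Nat.card A).Coprime p ∧ A.index ≤ B

theorem _root_.HasCyclicCharacteristic.of_card_le {B : ℕ} (hB : Nat.card G ≤ B) :
    HasCyclicCharacteristic p G B :=
  ⟨⊥, inferInstance, inferInstance, by simp, by simpa using hB⟩

theorem hasCyclicCharacteristic_of_index_two [Finite G] [CharP K p] [Fact p.Prime]
    (h : IsMoebiusAction p χ) {y : X} (hy : h.unipotent y = ⊥)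
    (hG : Nat.card (orbit G y) = 2) (h3 : 3 ≤ Nat.card (stabilizer G y))
    (h2 : ∀ x ∉ orbit G y, Nat.card (stabilizer G x) = 2) {B : ℕ} (hB : 2 ≤ B) :
    HasCyclicCharacteristic p G B := by
  have hcyc := h.isCyclic_stabilizer hy
  have hidx : (stabilizer G y).index = 2 := by rw [index_stabilizer, ← hG]; rfl
  have hnorm := Subgroup.normal_of_index_eq_two hidx
  have hsq : ∀ g ∉ stabilizer G y, g ^ 2 = 1 := by
    intro g hg
    obtain ⟨x, hx⟩ := h.exists_fixed g fun h0 ↦ hg (h0 ▸ one_mem _)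
    have hxy : x ∉ orbit G y := by
      rintro ⟨k, rfl⟩
      refine hg ?_
      have : k⁻¹ * g * k ∈ stabilizer G y := by
        rw [mem_stabilizer_iff, mul_smul, mul_smul, inv_smul_eq_iff]; exact hx
      simpa [mul_assoc] using hnorm.conj_mem _ this k
    have h1 : (⟨g, hx⟩ : stabilizer G x) ^ Nat.card (stabilizer G x) = 1 := pow_card_eq_one'
    rw [h2 x hxy] at h1
    exact congrArg Subtype.val h1
  refine ⟨stabilizer G y, Subgroup.characteristic_iff_map_le.2 fun φ ↦ ?_, hcyc,
    h.coprime_card_stabilizer hy, hidx.trans_le hB⟩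
  obtain ⟨a, ha⟩ := hcyc.exists_generator
  have haφ : φ a ∈ stabilizer G y := by
    by_contra hne
    have h1 := hsq _ hne
    rw [← map_pow, EmbeddingLike.map_eq_one_iff] at h1
    have h4 : orderOf a = Nat.card (stabilizer G y) := orderOf_eq_card_of_forall_mem_zpowers ha
    have h5 := orderOf_dvd_of_pow_eq_one (x := a) (n := 2) (Subtype.ext h1)
    have := Nat.le_of_dvd two_pos h5
    lia
  rintro _ ⟨b, hb, rfl⟩
  obtain ⟨n, hn⟩ := ha ⟨b, hb⟩
  have : b = (a : G) ^ n := congrArg Subtype.val hn.symm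
  rw [this]
  simpa using zpow_mem haφ n

/-- The factor `J_p` in the index bound. -/
abbrev _root_.jordanFactor (p : ℕ) : ℕ :=
  if 7 ≤ p then 60 else if p = 5 then 24 else if p = 3 then 4 else 1

theorem _root_.le_jordanFactor (hp : p.Prime) (h2 : ¬ p ∣ 2) : 4 ≤ jordanFactor p ∧
    (¬ p ∣ 3 → 24 ≤ jordanFactor p ∧ (¬ p ∣ 5 → 60 ≤ jordanFactor p)) := by
  unfold jordanFactor
  by_cases h7 : 7 ≤ p
  · simp [h7]
  · have : p < 7 := by lia
    interval_cases p <;> revert hp h2 <;> decide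

theorem hasCyclicCharacteristic_of_three_orbits [Finite G] [CharP K p] [hp : Fact p.Prime]
    (h : IsMoebiusAction p χ) (hU : ∀ x, h.unipotent x = ⊥)
    (hS : ∀ x : X, 2 ≤ Nat.card (stabilizer G x)) {a b c : X}
    (hX : ∀ x : X, x ∈ orbit G a ∨ x ∈ orbit G b ∨ x ∈ orbit G c)
    (hsum : Nat.card (orbit G a) + Nat.card (orbit G b) + Nat.card (orbit G c) = Nat.card G + 2)
    (hab : Nat.card (stabilizer G a) ≤ Nat.card (stabilizer G b))
    (hbc : Nat.card (stabilizer G b) ≤ Nat.card (stabilizer G c)) :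
    HasCyclicCharacteristic p G (jordanFactor p) := by
  have := Fintype.ofFinite G
  have hc : ∀ x, ¬ p ∣ Nat.card (stabilizer G x) := fun x ↦
    (Nat.Prime.coprime_iff_not_dvd hp.out).1 (h.coprime_card_stabilizer (hU x)).symm
  have ha' := card_orbit_mul_card_stabilizer (G := G) a
  have hb' := card_orbit_mul_card_stabilizer (G := G) b
  have hc' := card_orbit_mul_card_stabilizer (G := G) c
  rw [← Nat.card_eq_fintype_card] at ha' hb' hc'
  have hN : 0 < Nat.card G := Nat.card_pos
  have hpa := hc a
  have hpb := hc b
  have hpc := hc c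
  have h2a := hS a
  have hsa : ∀ x ∈ orbit G a, Nat.card (stabilizer G x) = Nat.card (stabilizer G a) := fun x hx ↦
    card_stabilizer_eq_of_mem_orbit hx
  have hsb : ∀ x ∈ orbit G b, Nat.card (stabilizer G x) = Nat.card (stabilizer G b) := fun x hx ↦
    card_stabilizer_eq_of_mem_orbit hx
  have hD := h.hasCyclicCharacteristic_of_index_two (hU c) (B := jordanFactor p)
  have hT := HasCyclicCharacteristic.of_card_le (p := p) (G := G) (B := jordanFactor p)
  generalize Nat.card (stabilizer G a) = l at *
  generalize Nat.card (stabilizer G b) = m at *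
  generalize Nat.card (stabilizer G c) = n at *
  generalize Nat.card (orbit G a) = u at *
  generalize Nat.card (orbit G b) = v at *
  generalize Nat.card (orbit G c) = w at *
  generalize Nat.card G = N at *
  have hl : l < 3 := by
    by_contra! h3
    nlinarith [Nat.mul_le_mul_left u h3, Nat.mul_le_mul_left v (h3.trans hab),
      Nat.mul_le_mul_left w (h3.trans (hab.trans hbc))]
  obtain rfl : l = 2 := by lia
  obtain ⟨hJ4, hJ⟩ := le_jordanFactor hp.out hpa
  have hm : m < 4 := by
    by_contra! h3
    nlinarith [Nat.mul_le_mul_left v h3, Nat.mul_le_mul_left w (h3.trans hbc)]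
  obtain rfl | rfl : m = 2 ∨ m = 3 := by lia
  · obtain rfl : w = 2 := by lia
    by_cases hn : 3 ≤ n
    · refine hD rfl hn (fun x hx ↦ ?_) (by lia)
      rcases hX x with hx' | hx' | hx'
      · exact hsa x hx'
      · exact hsb x hx'
      · exact (hx hx').elim
    · exact hT (by lia)
  · obtain ⟨hJ24, hJ60⟩ := hJ hpb
    have hn : n < 6 := by
      by_contra! h3
      nlinarith [Nat.mul_le_mul_left w h3]
    interval_cases n
    · exact hT (by lia)
    · exact hT (by lia)
    · have := hJ60 hpc
      exact hT (by lia)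

theorem hasCyclicCharacteristic_of_tame [Finite G] [Finite X] [CharP K p] [hp : Fact p.Prime]
    (h : IsMoebiusAction p χ) (hU : ∀ x, h.unipotent x = ⊥)
    (hS : ∀ x : X, 2 ≤ Nat.card (stabilizer G x)) :
    HasCyclicCharacteristic p G (jordanFactor p) := by
  classical
  have := Fintype.ofFinite G
  have := Fintype.ofFinite X
  have := Fintype.ofFinite (orbitRel.Quotient G X)
  have hJ : 1 ≤ jordanFactor p := by unfold jordanFactor; split_ifs <;> norm_num
  have hcount := h.sum_card_add_two
  have hXo := card_eq_sum_card_orbit (G := G) (X := X)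
  have hor : ∀ x : X, Nat.card (orbit G x) * Nat.card (stabilizer G x) = Nat.card G := fun x ↦ by
    rw [card_orbit_mul_card_stabilizer, Nat.card_eq_fintype_card]
  rw [Finset.sum_add_distrib, sum_card_stabilizer] at hcount
  simp only [hU, Subgroup.card_bot, Finset.sum_const, Finset.card_univ, smul_eq_mul, mul_one]
    at hcount
  rw [← Nat.card_eq_fintype_card (α := G)] at hcount
  have hN : 0 < Nat.card G := Nat.card_pos
  have hle : 2 * Fintype.card X ≤ Fintype.card (orbitRel.Quotient G X) * Nat.card G := by
    rw [hXo, Finset.mul_sum, ← smul_eq_mul (a := Fintype.card _), ← Finset.card_univ]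
    refine Finset.sum_le_card_nsmul _ _ _ fun ω _ ↦ ?_
    rw [← hor ω.out, mul_comm]
    exact Nat.mul_le_mul_left _ (hS _)
  have hr : Fintype.card (orbitRel.Quotient G X) < 4 := by
    by_contra! h4
    have := Nat.mul_le_mul_right (Nat.card G) h4
    lia
  have hmem : ∀ x : X, ∃ ω : orbitRel.Quotient G X, x ∈ orbit G ω.out := fun x ↦
    ⟨Quotient.mk'' x, by
      rw [← orbitRel_apply, ← Quotient.eq'']; exact (Quotient.out_eq' _).symm⟩
  have hpos : ∀ x : X, 0 < Nat.card (orbit G x) := fun x ↦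
    Nat.pos_of_mul_pos_right (hor x ▸ hN)
  interval_cases hcard : Fintype.card (orbitRel.Quotient G X)
  · exact .of_card_le (by lia)
  · obtain ⟨ω, -⟩ := Fintype.card_eq_one_iff.1 hcard
    have := Fintype.card_pos_iff.2 ⟨ω.out⟩
    exact .of_card_le (by lia)
  · obtain ⟨a, b, hab, huniv⟩ := Finset.card_eq_two.1 (Finset.card_univ.trans hcard)
    rw [huniv, Finset.sum_pair hab] at hXo
    have h1 := hpos a.out
    have h2 := hpos b.out
    have h3 : Nat.card (stabilizer G a.out) = Nat.card G := by
      rw [← hor a.out, show Nat.card (orbit G a.out) = 1 by lia, one_mul]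
    exact ⟨stabilizer G a.out, by rw [Subgroup.eq_top_of_card_eq _ h3]; infer_instance,
      h.isCyclic_stabilizer (hU _), h.coprime_card_stabilizer (hU _),
      by rw [Subgroup.eq_top_of_card_eq _ h3]; simpa using hJ⟩
  · obtain ⟨a, b, c, hab, hac, hbc, huniv⟩ :=
      Finset.card_eq_three.1 (Finset.card_univ.trans hcard)
    rw [huniv, Finset.sum_insert (by simp [hab, hac]), Finset.sum_pair hbc] at hXo
    have hX : ∀ x : X, x ∈ orbit G a.out ∨ x ∈ orbit G b.out ∨ x ∈ orbit G c.out := by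
      intro x
      obtain ⟨ω, hω⟩ := hmem x
      have : ω ∈ ({a, b, c} : Finset _) := huniv ▸ Finset.mem_univ ω
      simp only [Finset.mem_insert, Finset.mem_singleton] at this
      rcases this with rfl | rfl | rfl <;> simp [hω]
    have key := fun {a b c : X} ↦
      h.hasCyclicCharacteristic_of_three_orbits (a := a) (b := b) (c := c) hU hS
    rcases le_total (Nat.card (stabilizer G a.out)) (Nat.card (stabilizer G b.out)) with h1 | h1 <;>
    rcases le_total (Nat.card (stabilizer G a.out)) (Nat.card (stabilizer G c.out)) with h2 | h2 <;>
    rcases le_total (Nat.card (stabilizer G b.out)) (Nat.card (stabilizer G c.out)) with h3 | h3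
    · exact key (fun x ↦ by have := hX x; tauto) (by lia) h1 h3
    · exact key (fun x ↦ by have := hX x; tauto) (by lia) h2 h3
    · exact key (fun x ↦ by have := hX x; tauto) (by lia) h1 h3
    · exact key (fun x ↦ by have := hX x; tauto) (by lia) h2 h1
    · exact key (fun x ↦ by have := hX x; tauto) (by lia) h1 h2
    · exact key (fun x ↦ by have := hX x; tauto) (by lia) h1 h2
    · exact key (fun x ↦ by have := hX x; tauto) (by lia) h3 h2
    · exact key (fun x ↦ by have := hX x; tauto) (by lia) h3 h1

theorem mul_bound {q m n t : ℕ} (hq : 3 ≤ q) (hm : m < q)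
    (hN : t * (q * m) = n * (2 + t * (q - 2))) (ht : 0 < t) (hm0 : 0 < m) :
    t * (q * m) ≤ 4 * q ^ 3 ∧ (Even q → t * (q * m) ≤ q ^ 3) := by
  obtain ⟨r, rfl⟩ : ∃ r, q = r + 3 := ⟨q - 3, by lia⟩
  simp only [show r + 3 - 2 = r + 1 by lia] at hN
  have hlt : n * (r + 1) < (r + 3) * m := by
    by_contra! hle
    rcases Nat.eq_zero_or_pos n with rfl | hn
    · have : 0 < t * ((r + 3) * m) := by positivity
      lia
    · nlinarith [Nat.mul_le_mul_left t hle]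
  obtain ⟨d, hd⟩ := Nat.exists_eq_add_of_lt hlt
  have h1 : t * (d + 1) = 2 * n := by
    rw [hd] at hN
    nlinarith
  have hn' : n * (r + 1) + 1 ≤ (r + 3) * (r + 2) := by nlinarith
  have hmul : t * ((r + 3) * m) ≤ t * ((r + 3) * (r + 2)) := by gcongr; lia
  constructor
  · have hn : n ≤ r + 5 := by
      by_contra! h0
      nlinarith
    have ht2 : t ≤ 2 * (r + 5) := by nlinarith
    calc t * ((r + 3) * m) ≤ 2 * (r + 5) * ((r + 3) * (r + 2)) :=
          hmul.trans (Nat.mul_le_mul_right _ ht2)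
      _ ≤ 2 * (r + 5) * ((r + 3) * (r + 2)) + (2 * r ^ 3 + 16 * r ^ 2 + 46 * r + 48) :=
          Nat.le_add_right _ _
      _ = 4 * (r + 3) ^ 3 := by ring
  · intro hev
    have hd1 : 1 ≤ d := by
      rcases Nat.eq_zero_or_pos d with rfl | h0
      · exfalso
        obtain ⟨e, he⟩ := hev
        have h2 : r = 2 * (e - 2) + 1 := by lia
        have h3 : Even ((r + 3) * m) := by rw [he]; exact ⟨e * m, by ring⟩
        have h4 : Even (n * (r + 1)) := by rw [h2]; exact ⟨n * (e - 2 + 1), by ring⟩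
        rw [hd, add_zero] at h3
        exact Nat.even_add_one.1 h3 h4
      · exact h0
    have ht2 : t ≤ n := by nlinarith
    have hn : n ≤ r + 4 := by
      by_contra! h0
      nlinarith
    nlinarith [Nat.mul_le_mul_right ((r + 3) * (r + 2)) (ht2.trans hn)]

theorem hasCyclicCharacteristic_of_wild [Finite G] [Finite X] [CharP K p] [hp : Fact p.Prime]
    (h : IsMoebiusAction p χ) {x₀ : X} (hx₀ : h.unipotent x₀ ≠ ⊥)
    (hS : ∀ x : X, 2 ≤ Nat.card (stabilizer G x)) :
    HasCyclicCharacteristic p G (jordanFactor p * sylowCard p G ^ 3) := by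
  classical
  have := Fintype.ofFinite G
  have := Fintype.ofFinite X
  have := Fintype.ofFinite (orbitRel.Quotient G X)
  have hJ : 1 ≤ jordanFactor p := by unfold jordanFactor; split_ifs <;> norm_num
  have hcount := h.sum_card_add_two
  have hXo := card_eq_sum_card_orbit (G := G) (X := X)
  have hor : ∀ x : X, Nat.card (orbit G x) * Nat.card (stabilizer G x) = Nat.card G := fun x ↦ by
    rw [card_orbit_mul_card_stabilizer, Nat.card_eq_fintype_card]
  have hN : 0 < Nat.card G := Nat.card_pos
  have hpos : ∀ x : X, 0 < Nat.card (orbit G x) := fun x ↦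
    Nat.pos_of_mul_pos_right (hor x ▸ hN)
  obtain ⟨m, hm, hmq⟩ := h.exists_card_stabilizer_eq hx₀
  rw [h.card_unipotent hx₀] at hm hmq
  have hm0 : 0 < m := Nat.pos_of_ne_zero fun h0 ↦ by
    have := hS x₀
    rw [hm, h0, mul_zero] at this
    lia
  have hq2 : 2 ≤ sylowCard p G := by
    rw [← h.card_unipotent hx₀]
    exact (Subgroup.one_lt_card_iff_ne_bot _).2 hx₀
  have hsumU : ∑ x : X, Nat.card (h.unipotent x) =
      Fintype.card X + Nat.card (orbit G x₀) * (sylowCard p G - 1) := by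
    have h1 : ∀ x : X, Nat.card (h.unipotent x) =
        1 + if x ∈ orbit G x₀ then sylowCard p G - 1 else 0 := by
      intro x
      split_ifs with hx
      · rw [h.card_unipotent ((h.unipotent_ne_bot_iff hx₀).2 hx)]
        lia
      · rw [← h.unipotent_ne_bot_iff hx₀, not_not] at hx
        simp [hx]
    simp_rw [h1]
    rw [Finset.sum_add_distrib, ← Finset.sum_filter, Finset.sum_const, Finset.sum_const,
      ← Fintype.card_subtype, ← Nat.card_eq_fintype_card (α := {x // x ∈ orbit G x₀})]
    simp
  rw [Finset.sum_add_distrib, sum_card_stabilizer, hsumU, ← Nat.card_eq_fintype_card (α := G)]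
    at hcount
  have hx₀N := hor x₀
  rw [hm] at hx₀N
  let ω₀ : orbitRel.Quotient G X := Quotient.mk'' x₀
  have hω₀ : orbit G ω₀.out = orbit G x₀ := by
    rw [orbit_eq_iff, ← orbitRel_apply, ← Quotient.eq'']
    exact Quotient.out_eq' _
  rw [← Finset.add_sum_erase _ _ (Finset.mem_univ ω₀), hω₀] at hXo
  have hcardE : (Finset.univ.erase ω₀).card + 1 = Fintype.card (orbitRel.Quotient G X) := by
    rw [Finset.card_erase_of_mem (Finset.mem_univ _), Finset.card_univ]
    have := Fintype.card_pos_iff.2 ⟨ω₀⟩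
    lia
  have hle : 2 * ∑ ω ∈ Finset.univ.erase ω₀, Nat.card (orbit G ω.out) ≤
      (Finset.univ.erase ω₀).card * Nat.card G := by
    rw [Finset.mul_sum, ← smul_eq_mul (a := Finset.card _)]
    refine Finset.sum_le_card_nsmul _ _ _ fun ω _ ↦ ?_
    rw [← hor ω.out, mul_comm]
    exact Nat.mul_le_mul_left _ (hS _)
  rw [← hcardE] at hcount
  have ht := hpos x₀
  have hq3 : sylowCard p G ≤ jordanFactor p * sylowCard p G ^ 3 := by
    have := Nat.le_self_pow three_ne_zero (sylowCard p G)
    nlinarith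
  have hr : (Finset.univ.erase ω₀).card < 2 := by
    by_contra! h4
    have h5 := Nat.mul_le_mul_right (Nat.card G) h4
    have h6 := Nat.mul_le_mul_left (Nat.card (orbit G x₀)) (show 1 ≤ sylowCard p G - 1 by lia)
    lia
  interval_cases hcard : (Finset.univ.erase ω₀).card
  · rw [Finset.card_eq_zero] at hcard
    rw [hcard, Finset.sum_empty] at hXo
    refine .of_card_le (le_trans ?_ hq3)
    generalize sylowCard p G = q at *
    generalize Nat.card (orbit G x₀) = t at *
    obtain ⟨r, rfl⟩ : ∃ r, q = r + 2 := ⟨q - 2, by lia⟩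
    rw [show r + 2 - 1 = r + 1 by lia, hXo] at hcount
    have ht1 : t ≤ 1 := by
      nlinarith [Nat.mul_le_mul_left (t * (r + 2)) hm0]
    obtain rfl : t = 1 := by lia
    lia
  · obtain ⟨ω₁, hω₁⟩ := Finset.card_eq_one.1 hcard
    rw [hω₁, Finset.sum_singleton] at hXo
    have hne : ω₁ ≠ ω₀ := Finset.ne_of_mem_erase (hω₁ ▸ Finset.mem_singleton_self ω₁)
    have hcover : ∀ x ∉ orbit G ω₁.out, x ∈ orbit G x₀ := by
      intro x hx
      by_contra hx'
      have hmem : (Quotient.mk'' x : orbitRel.Quotient G X) ∈ Finset.univ.erase ω₀ := by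
        refine Finset.mem_erase.2 ⟨fun h0 ↦ hx' ?_, Finset.mem_univ _⟩
        rwa [← orbitRel_apply, ← Quotient.eq'']
      rw [hω₁, Finset.mem_singleton] at hmem
      refine hx ?_
      rw [← hmem, ← orbitRel_apply, ← Quotient.eq'']
      exact (Quotient.out_eq' _).symm
    have htame : h.unipotent ω₁.out = ⊥ := by
      by_contra h0
      rw [← ne_eq, h.unipotent_ne_bot_iff hx₀, ← orbitRel_apply, ← Quotient.eq''] at h0
      exact hne ((Quotient.out_eq' ω₁).symm.trans h0)
    have hcop := h.coprime_card_stabilizer htame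
    have hstab : ∀ x ∈ orbit G x₀, Nat.card (stabilizer G x) = sylowCard p G * m :=
      fun x hx ↦ (card_stabilizer_eq_of_mem_orbit hx).trans hm
    have hn2 := hS ω₁.out
    have hnN := hor ω₁.out
    have he : p = 2 ↔ Even (sylowCard p G) := by
      rw [← hp.out.even_iff, sylowCard, Nat.even_pow, iff_self_and]
      rintro - h0
      rw [sylowCard, h0, pow_zero] at hq2
      lia
    have ho : Nat.card (orbit G ω₁.out) = 2 + Nat.card (orbit G x₀) * (sylowCard p G - 2) := by
      have : sylowCard p G - 1 = (sylowCard p G - 2) + 1 := by lia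
      rw [this, mul_add, mul_one, hXo] at hcount
      lia
    rcases hq2.eq_or_lt with hq | hq
    · have hp2 : p = 2 := he.2 (by simp [← hq])
      refine h.hasCyclicCharacteristic_of_index_two htame (by rw [ho, ← hq]; simp) ?_
        (fun x hx ↦ by rw [hstab x (hcover x hx)]; lia) (hq2.trans hq3)
      rw [hp2, Nat.coprime_two_right] at hcop
      obtain ⟨e, he⟩ := hcop
      lia
    · obtain ⟨h4, hev⟩ := mul_bound hq hmq (n := Nat.card (stabilizer G ω₁.out))
        (by rw [hx₀N, ← hnN, ho, mul_comm]) ht hm0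
      rw [hx₀N] at h4 hev
      refine .of_card_le ?_
      by_cases hp2 : p = 2
      · exact (hev (he.1 hp2)).trans (Nat.le_mul_of_pos_left _ hJ)
      · refine h4.trans (Nat.mul_le_mul_right _ (le_jordanFactor hp.out fun h0 ↦ hp2 ?_).1)
        exact (Nat.prime_dvd_prime_iff_eq hp.out Nat.prime_two).1 h0

theorem hasCyclicCharacteristic [Finite G] [Finite X] [CharP K p] [hp : Fact p.Prime]
    (h : IsMoebiusAction p χ) (hS : ∀ x : X, 2 ≤ Nat.card (stabilizer G x)) :
    HasCyclicCharacteristic p G (jordanFactor p * sylowCard p G ^ 3) := by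
  by_cases hU : ∀ x, h.unipotent x = ⊥
  · obtain ⟨A, h1, h2, h3, h4⟩ := h.hasCyclicCharacteristic_of_tame hU hS
    exact ⟨A, h1, h2, h3, h4.trans (Nat.le_mul_of_pos_right _ (by
      unfold sylowCard; have := hp.out.pos; positivity))⟩
  · push Not at hU
    obtain ⟨x₀, hx₀⟩ := hU
    exact h.hasCyclicCharacteristic_of_wild hx₀ hS

/-- The points fixed by some nontrivial group element. -/
def _root_.specialPoints (G X : Type*) [Group G] [MulAction G X] : SubMulAction G X where
  carrier := {x | ∃ g : G, g ≠ 1 ∧ g • x = x}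
  smul_mem' := by
    rintro k x ⟨g, hg, hx⟩
    exact ⟨k * g * k⁻¹, by simpa using hg, by simp [mul_smul, hx]⟩

theorem finite_specialPoints [Finite G] (h : IsMoebiusAction p χ) :
    Finite (specialPoints G X) := by
  refine (Set.Finite.subset (Set.finite_iUnion fun g : {g : G // g ≠ 1} ↦
    (?_ : {x : X | (g : G) • x = x}.Finite)) ?_ : {x | x ∈ specialPoints G X}.Finite)
  · obtain ⟨x, hx⟩ := h.exists_fixed g g.2
    by_cases hχ : χ x g = 1
    · exact (Set.finite_singleton x).subset fun y hy ↦ h.fixed_unique g g.2 x y hx hχ hy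
    · obtain ⟨y, -, -, hy⟩ := h.fixed_pair g x hx hχ
      exact (Set.toFinite {x, y}).subset fun z hz ↦ hy z hz
  · rintro x ⟨g, hg, hx⟩
    exact Set.mem_iUnion.2 ⟨⟨g, hg⟩, hx⟩

theorem restrict_specialPoints (h : IsMoebiusAction p χ) :
    IsMoebiusAction p (fun (x : specialPoints G X) (g : G) ↦ χ x g) where
  map_one x := h.map_one x
  map_mul x a b ha hb := h.map_mul x a b (congrArg Subtype.val ha) (congrArg Subtype.val hb)
  exists_fixed g hg := by
    obtain ⟨x, hx⟩ := h.exists_fixed g hg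
    exact ⟨⟨x, g, hg, hx⟩, Subtype.ext hx⟩
  fixed_unique g hg x y hx hχ hy := Subtype.ext
    (h.fixed_unique g hg x y (congrArg Subtype.val hx) hχ (congrArg Subtype.val hy))
  fixed_pair g x hx hχ := by
    obtain ⟨y, hyx, hy, hz⟩ := h.fixed_pair g x (congrArg Subtype.val hx) hχ
    have hg : g ≠ 1 := by rintro rfl; exact hχ (h.map_one x)
    exact ⟨⟨y, g, hg, hy⟩, fun h0 ↦ hyx (congrArg Subtype.val h0), Subtype.ext hy,
      fun z hzz ↦ (hz z (congrArg Subtype.val hzz)).imp Subtype.ext Subtype.ext⟩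
  pow_eq_one g x hx hχ := h.pow_eq_one g x (congrArg Subtype.val hx) hχ

theorem hasCyclicCharacteristic_of_finite [Finite G] [CharP K p] [hp : Fact p.Prime]
    (h : IsMoebiusAction p χ) :
    HasCyclicCharacteristic p G (jordanFactor p * sylowCard p G ^ 3) := by
  have := h.finite_specialPoints
  refine h.restrict_specialPoints.hasCyclicCharacteristic ?_
  rintro ⟨x, g, hg, hx⟩
  refine (Subgroup.one_lt_card_iff_ne_bot _).2 fun h0 ↦ hg ?_
  rw [← Subgroup.mem_bot, ← h0]
  exact Subtype.ext hx

end IsMoebiusAction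

end MoebiusAction

section MatrixFacts

open Matrix

variable {K : Type*} [Field K] {A : Matrix (Fin 2) (Fin 2) K} {v w : Fin 2 → K} {l m : K}

theorem mulVec_eq_smul_iff : A *ᵥ v = l • v ↔
    A 0 0 * v 0 + A 0 1 * v 1 = l * v 0 ∧ A 1 0 * v 0 + A 1 1 * v 1 = l * v 1 := by
  simp [funext_iff, Fin.forall_fin_two]

theorem ne_zero_iff_fin_two : v ≠ 0 ↔ v 0 ≠ 0 ∨ v 1 ≠ 0 := by
  simp [funext_iff, Fin.forall_fin_two, imp_iff_not_or]

theorem sub_mul_sub_eq_of_mulVec_eq_smul (hv : v ≠ 0) (h : A *ᵥ v = l • v) :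
    l * (A.trace - l) = A.det := by
  rw [mulVec_eq_smul_iff] at h
  obtain ⟨h0, h1⟩ := h
  rw [trace_fin_two, det_fin_two]
  rcases ne_zero_iff_fin_two.1 hv with hv | hv <;> apply mul_right_cancel₀ hv
  · linear_combination (A 1 1 - l) * (-h0) + A 0 1 * h1
  · linear_combination (A 0 0 - l) * (-h1) + A 1 0 * h0

theorem eq_smul_one_of_mulVec_eq_smul (hv : v ≠ 0) (hw : w ≠ 0)
    (hne : Projectivization.mk K v hv ≠ Projectivization.mk K w hw)
    (h : A *ᵥ v = l • v) (h' : A *ᵥ w = l • w) : A = l • 1 := by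
  have hli : LinearIndependent K ![v, w] := by
    rw [LinearIndependent.pair_iff' hv]
    intro a ha
    exact hne ((Projectivization.mk_eq_mk_iff' K v w hv hw).2 ⟨a⁻¹, by
      rw [← ha, smul_smul, inv_mul_cancel₀, one_smul]; rintro rfl; simp at ha; exact hw ha.symm⟩)
  let b := basisOfLinearIndependentOfCardEqFinrank hli (by simp)
  apply Matrix.toLin'.injective
  refine b.ext fun i ↦ ?_
  fin_cases i <;> simp [b, h, h']

theorem exists_mulVec_eq_smul (h : l * (A.trace - l) = A.det) (hA : A ≠ (A.trace - l) • 1) :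
    ∃ w : Fin 2 → K, w ≠ 0 ∧ A *ᵥ w = l • w := by
  by_contra! hw
  rw [trace_fin_two, det_fin_two] at h
  have h1 := hw ![A 0 0 - (A.trace - l), A 1 0]
  have h2 := hw ![A 0 1, A 1 1 - (A.trace - l)]
  simp only [ne_eq, mulVec_eq_smul_iff, trace_fin_two] at h1 h2
  have h1' : ![A 0 0 - (A 0 0 + A 1 1 - l), A 1 0] = 0 := by
    by_contra h0
    refine h1 h0 ⟨?_, ?_⟩ <;> simp
    · linear_combination h
    · ring
  have h2' : ![A 0 1, A 1 1 - (A 0 0 + A 1 1 - l)] = 0 := by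
    by_contra h0
    refine h2 h0 ⟨?_, ?_⟩ <;> simp
    · ring
    · linear_combination h
  simp only [Matrix.cons_eq_zero_iff] at h1' h2'
  apply hA
  ext i j
  fin_cases i <;> fin_cases j <;> simp [trace_fin_two, h1', h2']
  · linear_combination h1'.1
  · linear_combination h2'.2.1

theorem pow_char_eq_smul_one {p : ℕ} [hp : Fact p.Prime] [CharP K p] (hv : v ≠ 0)
    (h : A *ᵥ v = l • v) (hl : A.trace - l = l) : A ^ p = l ^ p • 1 := by
  have hdet := sub_mul_sub_eq_of_mulVec_eq_smul hv h
  rw [hl] at hdet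
  have h2 : (A - l • 1) ^ 2 = 0 := by
    rw [det_fin_two] at hdet
    rw [trace_fin_two] at hl
    ext i j
    fin_cases i <;> fin_cases j <;> simp [pow_two, mul_apply, Fin.sum_univ_two]
    · linear_combination A 0 0 * hl + hdet
    · linear_combination A 0 1 * hl
    · linear_combination A 1 0 * hl
    · linear_combination A 1 1 * hl + hdet
  have h3 : (A - l • 1) ^ p = 0 := pow_eq_zero_of_le hp.out.two_le h2
  rw [sub_pow_char_of_commute _ (Commute.one_right A |>.smul_right l), sub_eq_zero] at h3
  rw [h3, smul_pow, one_pow]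

end MatrixFacts

section Projective

open Matrix

open scoped LinearAlgebra.Projectivization

variable {K G : Type*} [Field K] [Group G]

/-- The eigenvalue of `A` on the line `x`, when `x` is an eigenline. -/
noncomputable def lineEigenvalue (A : Matrix (Fin 2) (Fin 2) K) (x : ℙ K (Fin 2 → K)) : K :=
  Classical.epsilon fun l ↦ A *ᵥ x.rep = l • x.rep

theorem lineEigenvalue_eq {A : Matrix (Fin 2) (Fin 2) K} {x : ℙ K (Fin 2 → K)} {l : K}
    (h : A *ᵥ x.rep = l • x.rep) : lineEigenvalue A x = l := by
  have h1 : A *ᵥ x.rep = lineEigenvalue A x • x.rep :=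
    Classical.epsilon_spec (p := fun l ↦ A *ᵥ x.rep = l • x.rep) ⟨l, h⟩
  exact smul_left_injective K x.rep_nonzero (h1.symm.trans h)

theorem exists_isMoebiusAction {p : ℕ} [Fact p.Prime] [CharP K p] [IsAlgClosed K]
    [MulAction G (ℙ K (Fin 2 → K))] (M : G → Matrix (Fin 2) (Fin 2) K)
    (hdet : ∀ g, (M g).det ≠ 0) (hmul : ∀ g h, ∃ c : K, c ≠ 0 ∧ M (g * h) = c • (M g * M h))
    (hone : ∀ g (c : K), M g = c • 1 → g = 1)
    (hsmul : ∀ g (x : ℙ K (Fin 2 → K)), g • x = x ↔ ∃ l : K, M g *ᵥ x.rep = l • x.rep) :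
    ∃ χ : ℙ K (Fin 2 → K) → G → K, IsMoebiusAction p χ := by
  have hM1 : ∃ c : K, c ≠ 0 ∧ M 1 = c • 1 := by
    obtain ⟨c, hc, h⟩ := hmul 1 1
    rw [mul_one, ← mul_smul_comm] at h
    have hu : IsUnit (M 1) := (isUnit_iff_isUnit_det _).2 (hdet 1).isUnit
    have h1 : c • M 1 = 1 := hu.mul_left_cancel (by rw [← h, mul_one])
    exact ⟨c⁻¹, inv_ne_zero hc, by rw [← h1, smul_smul, inv_mul_cancel₀ hc, one_smul]⟩
  have hpow : ∀ g n, ∃ c : K, c ≠ 0 ∧ M (g ^ n) = c • M g ^ n := by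
    intro g n
    induction n with
    | zero => simpa using hM1
    | succ n ih =>
      obtain ⟨c, hc, h⟩ := ih
      obtain ⟨d, hd, h'⟩ := hmul (g ^ n) g
      exact ⟨d * c, mul_ne_zero hd hc, by rw [pow_succ, h', h, pow_succ, smul_mul_assoc, smul_smul]⟩
  have hspec : ∀ g x, g • x = x → M g *ᵥ x.rep = lineEigenvalue (M g) x • x.rep := fun g x hx ↦
    Classical.epsilon_spec ((hsmul g x).1 hx)
  have hprod : ∀ g x, g • x = x → lineEigenvalue (M g) x *
      ((M g).trace - lineEigenvalue (M g) x) = (M g).det := fun g x hx ↦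
    sub_mul_sub_eq_of_mulVec_eq_smul x.rep_nonzero (hspec g x hx)
  have hne : ∀ g x, g • x = x → lineEigenvalue (M g) x ≠ 0 := fun g x hx h0 ↦ hdet g <| by
    rw [← hprod g x hx, h0, zero_mul]
  have hχ : ∀ g x, g • x = x → (lineEigenvalue (M g) x ^ 2 / (M g).det = 1 ↔
      (M g).trace - lineEigenvalue (M g) x = lineEigenvalue (M g) x) := by
    intro g x hx
    rw [div_eq_one_iff_eq (hdet g), ← hprod g x hx, pow_two, mul_right_inj' (hne g x hx), eq_comm]
  have hscalar : ∀ g x y, g • x = x → g • y = y → x ≠ y →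
      lineEigenvalue (M g) x = lineEigenvalue (M g) y → g = 1 := by
    intro g x y hx hy hxy h
    refine hone g _ (eq_smul_one_of_mulVec_eq_smul x.rep_nonzero y.rep_nonzero (by simpa using hxy)
      (hspec g x hx) ?_)
    rw [h]
    exact hspec g y hy
  refine ⟨fun x g ↦ lineEigenvalue (M g) x ^ 2 / (M g).det, ?_, ?_, ?_, ?_, ?_, ?_⟩
  · intro x
    obtain ⟨c, hc, h⟩ := hM1
    rw [h, lineEigenvalue_eq (l := c) (by simp [smul_mulVec]), det_smul]
    simp [hc]
  · intro x g h hg hh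
    obtain ⟨c, hc, e⟩ := hmul g h
    have : lineEigenvalue (M (g * h)) x = c * (lineEigenvalue (M h) x * lineEigenvalue (M g) x) :=
      lineEigenvalue_eq (by
        rw [e, smul_mulVec, ← mulVec_mulVec, hspec h x hh, mulVec_smul, hspec g x hg, smul_smul,
          smul_smul, mul_assoc])
    rw [this, e, det_smul, det_mul, Fintype.card_fin]
    have := hdet g
    have := hdet h
    field_simp
  · intro g _
    obtain ⟨l, hl⟩ := Module.End.exists_eigenvalue (Matrix.toLin' (M g))
    obtain ⟨v, hv⟩ := hl.exists_hasEigenvector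
    have h1 : M g *ᵥ v = l • v := by simpa using hv.apply_eq_smul
    obtain ⟨a, ha⟩ := Projectivization.exists_smul_eq_mk_rep K v hv.2
    refine ⟨Projectivization.mk K v hv.2, (hsmul _ _).2 ⟨l, ?_⟩⟩
    rw [← ha, Units.smul_def, mulVec_smul, h1, smul_comm]
  · intro g hg x y hx h1 hy
    by_contra hxy
    refine hg (hscalar g y x hy hx hxy ?_)
    rw [hχ g x hx] at h1
    have e1 := hprod g x hx
    have e2 := hprod g y hy
    have : (lineEigenvalue (M g) y - lineEigenvalue (M g) x) ^ 2 = 0 := by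
      linear_combination (lineEigenvalue (M g) y - lineEigenvalue (M g) x) * h1 + e1 - e2
    exact sub_eq_zero.1 (pow_eq_zero_iff two_ne_zero |>.1 this)
  · intro g x hx h1
    rw [Ne, hχ g x hx] at h1
    set l := lineEigenvalue (M g) x with hl
    have e1 := hprod g x hx
    rw [← hl] at e1
    have hg : g ≠ 1 := by
      rintro rfl
      obtain ⟨c, hc, h⟩ := hM1
      have : l = c := lineEigenvalue_eq (by rw [h, smul_mulVec, one_mulVec])
      apply h1
      rw [h, trace_smul, trace_one, this]
      simp
      ring
    obtain ⟨w, hw, hw'⟩ := exists_mulVec_eq_smul (A := M g) (l := (M g).trace - l)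
      (by rw [← e1]; ring) (fun h ↦ hg (hone g _ h))
    obtain ⟨a, ha⟩ := Projectivization.exists_smul_eq_mk_rep K w hw
    have hy : M g *ᵥ (Projectivization.mk K w hw).rep =
        ((M g).trace - l) • (Projectivization.mk K w hw).rep := by
      rw [← ha, Units.smul_def, mulVec_smul, hw', smul_comm]
    have hgy := (hsmul _ _).2 ⟨_, hy⟩
    have hy' := lineEigenvalue_eq hy
    refine ⟨_, ?_, hgy, ?_⟩
    · intro h
      rw [h] at hy'
      exact h1 hy'.symm
    · intro z hz
      by_contra! hzz
      have e2 := hprod g z hz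
      have : (lineEigenvalue (M g) z - l) * (lineEigenvalue (M g) z - ((M g).trace - l)) = 0 := by
        linear_combination e1 - e2
      rcases mul_eq_zero.1 this with h | h
      · exact hg (hscalar g z x hz hx hzz.1 (sub_eq_zero.1 h))
      · exact hg (hscalar g z _ hz hgy hzz.2 (by rw [hy']; exact sub_eq_zero.1 h))
  · intro g x hx h1
    rw [hχ g x hx] at h1
    obtain ⟨c, hc, h⟩ := hpow g p
    refine hone _ (c * lineEigenvalue (M g) x ^ p) ?_
    rw [h, pow_char_eq_smul_one x.rep_nonzero (hspec g x hx) h1, smul_smul]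

/-- The action of `PGL₂(k)` on the projective line over an extension `K` of `k`. -/
noncomputable def projectiveLinePerm (k K : Type*) [Field k] [Field K] [Algebra k K] :
    PGL2 k →* Equiv.Perm (ℙ K (Fin 2 → K)) :=
  QuotientGroup.lift (Subgroup.center (GL (Fin 2) k))
    ((MulAction.toPermHom (LinearMap.GeneralLinearGroup K (Fin 2 → K)) (ℙ K (Fin 2 → K))).comp
      ((GeneralLinearGroup.toLin (n := Fin 2) (R := K)).toMonoidHom.comp
        (GeneralLinearGroup.map (algebraMap k K)))) <| by
    intro g hg
    obtain ⟨c, hc⟩ := GeneralLinearGroup.mem_center_iff_val_mem_range_scalar.1 hg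
    have hc0 : c ≠ 0 := by
      rintro rfl
      exact g.ne_zero (by rw [← hc, map_zero])
    ext x : 1
    induction x with
    | h v hv =>
      refine (Projectivization.mk_eq_mk_iff' K _ v _ hv).2 ⟨algebraMap k K c, ?_⟩
      change _ = (g : Matrix (Fin 2) (Fin 2) k).map (algebraMap k K) *ᵥ v
      rw [← hc]
      simp [diagonal_map]

theorem projectiveLinePerm_apply_eq_iff {k K : Type*} [Field k] [Field K] [Algebra k K]
    (g : GL (Fin 2) k) (x : ℙ K (Fin 2 → K)) :
    projectiveLinePerm k K g x = x ↔
      ∃ l : K, (g : Matrix (Fin 2) (Fin 2) k).map (algebraMap k K) *ᵥ x.rep = l • x.rep := by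
  have h : projectiveLinePerm k K g x =
      GeneralLinearGroup.toLin (GeneralLinearGroup.map (algebraMap k K) g) • x := rfl
  rw [h]
  conv_lhs => rw [← x.mk_rep]
  rw [Projectivization.smul_mk, Projectivization.mk_eq_mk_iff']
  exact exists_congr fun _ ↦ eq_comm

theorem exists_isMoebiusAction_of_subgroup {p : ℕ} [Fact p.Prime] {k : Type*} [Field k] [CharP k p]
    (G : Subgroup (PGL2 k)) :
    ∃ (_ : MulAction G (ℙ (AlgebraicClosure k) (Fin 2 → AlgebraicClosure k)))
      (χ : ℙ (AlgebraicClosure k) (Fin 2 → AlgebraicClosure k) → G → AlgebraicClosure k),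
      IsMoebiusAction p χ := by
  let K := AlgebraicClosure k
  have : CharP K p := charP_of_injective_algebraMap (algebraMap k K).injective p
  let _ : MulAction G (ℙ K (Fin 2 → K)) :=
    MulAction.compHom _ ((projectiveLinePerm k K).comp G.subtype)
  refine ⟨inferInstance, ?_⟩
  have hout : ∀ g : PGL2 k, ((g.out : GL (Fin 2) k) : PGL2 k) = g := fun g ↦ g.out_eq'
  refine exists_isMoebiusAction
    (fun g ↦ ((g : PGL2 k).out : Matrix (Fin 2) (Fin 2) k).map (algebraMap k K)) ?_ ?_ ?_ ?_
  · intro g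
    rw [← RingHom.mapMatrix_apply, ← RingHom.map_det]
    simpa using (GeneralLinearGroup.det (g : PGL2 k).out).ne_zero
  · intro g h
    have : ((g : PGL2 k).out * (h : PGL2 k).out)⁻¹ * ((g * h : G) : PGL2 k).out ∈
        Subgroup.center (GL (Fin 2) k) := by
      rw [← QuotientGroup.eq]
      simp [hout]
    obtain ⟨c, hc⟩ := GeneralLinearGroup.center_eq_range_scalar.le this
    rw [eq_inv_mul_iff_mul_eq] at hc
    refine ⟨algebraMap k K c, by simp, ?_⟩
    rw [← hc]
    ext i j
    fin_cases i <;> fin_cases j <;>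
      simp [mul_apply, Fin.sum_univ_two, diagonal_apply] <;> ring
  · intro g c h
    refine Subtype.ext ?_
    rw [← hout g]
    refine (QuotientGroup.eq_one_iff _).2 ?_
    refine GeneralLinearGroup.mem_center_iff_val_mem_range_scalar.2
      ⟨((g : PGL2 k).out : Matrix (Fin 2) (Fin 2) k) 0 0, ?_⟩
    have hij := fun i j ↦ congrFun (congrFun h i) j
    have h00 := hij 0 0
    ext i j
    apply (algebraMap k K).injective
    have h1 := hij i j
    fin_cases i <;> fin_cases j <;> simp_all
  · intro g x
    rw [← projectiveLinePerm_apply_eq_iff, hout]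
    rfl

end Projective

theorem stmt16 (p : ℕ) (hp : p.Prime) (k : Type*) [Field k] [CharP k p]
    (G : Subgroup (PGL2 k)) (hG : Finite G) :
    ∃ A : Subgroup G, A.Characteristic ∧ IsCyclic ↥A ∧ Nat.Coprime (Nat.card A) p ∧
      A.index ≤ (if 7 ≤ p then 60 else if p = 5 then 24 else if p = 3 then 4 else 1) *
        sylowCard p ↥G ^ 3 := by
  have := Fact.mk hp
  have : CharP (AlgebraicClosure k) p :=
    charP_of_injective_algebraMap (algebraMap k (AlgebraicClosure k)).injective p
  obtain ⟨_, χ, h⟩ := exists_isMoebiusAction_of_subgroup (p := p) G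
  exact h.hasCyclicCharacteristic_of_finite
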